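/- arXiv:2409.02940 — 2 statements merged into one kernel-verified Lean document; each statement's English description precedes it below -/
import Mathlib

section
/- Let r ≥ 2 and let J = (i_1, …, i_l) be a sequence with each i_t ∈ {1, …, r−1}. In the Bott–Samelson ring R_J, for every j ∈ {1, …, r} the identity e_j(y_1, …, y_r) = e_j(x_1, …, x_r) holds, where e_j denotes the j-th elementary symmetric polynomial; consequently the assignment x_i ↦ x_i, y_i ↦ y_i determines a well-defined ring homomorphism φ_J : 𝔉 → R_J. -/
noncomputable section
open MvPolynomial

/-- The polynomial ring `ℤ[x_1,…,x_r,δ_1,…,δ_l]` with `r = m + 2` strands: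
`Sum.inl` indexes the `x`'s and `Sum.inr` indexes the `δ`'s. -/
abbrev BSPoly (m l : ℕ) := MvPolynomial (Fin (m + 2) ⊕ Fin l) ℤ

/-- The Bott–Samelson relation attached to `t`:
`δ_t·(δ_t + x_{i_t} − x_{i_t+1} + 2·Σ_{s<t, i_s=i_t} δ_s − Σ_{s<t, |i_s−i_t|=1} δ_s)`.
Crossing indices are zero-based: `i t : Fin (m+1)` encodes the simple reflection between
strands `i t` and `i t + 1` (zero-based), so `x_{i_t} = X (Sum.inl (i t).castSucc)` and
`x_{i_t+1} = X (Sum.inl (i t).succ)`. -/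
def BSrel (m l : ℕ) (i : Fin l → Fin (m + 1)) (t : Fin l) : BSPoly m l :=
  X (Sum.inr t) *
    (X (Sum.inr t) + X (Sum.inl (i t).castSucc) - X (Sum.inl (i t).succ)
      + 2 * ∑ s ∈ Finset.univ.filter fun s => s < t ∧ i s = i t, X (Sum.inr s)
      - ∑ s ∈ Finset.univ.filter
          fun s => s < t ∧ ((i s : ℕ) = (i t : ℕ) + 1 ∨ (i t : ℕ) = (i s : ℕ) + 1),
          X (Sum.inr s))

/-- The Bott–Samelson ring `R_J = ℤ[x,δ]/I_J`. -/
abbrev BSRing (m l : ℕ) (i : Fin l → Fin (m + 1)) :=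
  BSPoly m l ⧸ Ideal.span (Set.range (BSrel m l i))

/-- `x_j ∈ R_J`. -/
def xB (m l : ℕ) (i : Fin l → Fin (m + 1)) (j : Fin (m + 2)) : BSRing m l i :=
  Ideal.Quotient.mk _ (X (Sum.inl j))

/-- `δ_t ∈ R_J`. -/
def δB (m l : ℕ) (i : Fin l → Fin (m + 1)) (t : Fin l) : BSRing m l i :=
  Ideal.Quotient.mk _ (X (Sum.inr t))

/-- `δ̂_c = Σ_{t : i_t = c} δ_t ∈ R_J`, indexed by an integer `c` so that the conventions
`δ̂_0 = δ̂_r = 0` (one-based) hold automatically. -/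
def δhat (m l : ℕ) (i : Fin l → Fin (m + 1)) (c : ℤ) : BSRing m l i :=
  ∑ t ∈ Finset.univ.filter fun t => ((i t : ℕ) : ℤ) = c, δB m l i t

/-- `y_j = x_j + δ̂_j − δ̂_{j−1} ∈ R_J` (zero-based `j`). -/
def yB (m l : ℕ) (i : Fin l → Fin (m + 1)) (j : Fin (m + 2)) : BSRing m l i :=
  xB m l i j + δhat m l i (j : ℤ) - δhat m l i ((j : ℤ) - 1)

/-- The ring homomorphism `ℤ[x_1,…,x_r,y_1,…,y_r] → R_J`, `x_j ↦ x_j`, `y_j ↦ y_j`. -/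
def toBS (m l : ℕ) (i : Fin l → Fin (m + 1)) :
    MvPolynomial (Fin (m + 2) ⊕ Fin (m + 2)) ℤ →+* BSRing m l i :=
  (MvPolynomial.aeval fun v => Sum.elim (xB m l i) (yB m l i) v).toRingHom

/-- The ring homomorphism `ℤ[x_1,…,x_r] → R_J`, `x_j ↦ x_j`. -/
def ψBS (m l : ℕ) (i : Fin l → Fin (m + 1)) :
    MvPolynomial (Fin (m + 2)) ℤ →+* BSRing m l i :=
  (MvPolynomial.aeval fun j => xB m l i j).toRingHom

/-- The `k`-th elementary symmetric function of a finite family of ring elements: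
`e_k(v) = Σ_{S ⊆ ι, |S| = k} Π_{j ∈ S} v j`. -/
def esym {R : Type*} [CommRing R] {ι : Type*} [Fintype ι] [DecidableEq ι]
    (k : ℕ) (v : ι → R) : R :=
  ∑ S ∈ Finset.univ.powersetCard k, ∏ j ∈ S, v j

/-- The polynomial ring `ℤ[x_1,…,x_r,y_1,…,y_r]`. -/
abbrev FPoly (r : ℕ) := MvPolynomial (Fin r ⊕ Fin r) ℤ

/-- The relation `e_{j+1}(x) − e_{j+1}(y)`. -/
def Frel (r : ℕ) (j : Fin r) : FPoly r :=
  esym ((j : ℕ) + 1) (fun i : Fin r => (X (Sum.inl i) : FPoly r)) -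
    esym ((j : ℕ) + 1) (fun i : Fin r => (X (Sum.inr i) : FPoly r))

/-- The ring `𝔉 = ℤ[x,y]/(e_1(x) − e_1(y), …, e_r(x) − e_r(y))`. -/
abbrev FRing (r : ℕ) := FPoly r ⧸ Ideal.span (Set.range (Frel r))

/-- Equal generating products `∏ (T + v j)` have equal elementary symmetric functions. -/
theorem esym_eq_of_prod_X_add_C_eq {R : Type*} [CommRing R] {ι : Type*} [Fintype ι]
    [DecidableEq ι] {v w : ι → R}
    (h : ∏ j, (Polynomial.X + Polynomial.C (v j)) = ∏ j, (Polynomial.X + Polynomial.C (w j)))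
    (k : ℕ) : esym k v = esym k w := by
  unfold esym
  by_cases hk : k ≤ (Finset.univ : Finset ι).card
  · have hc := congrArg (fun p => p.coeff ((Finset.univ : Finset ι).card - k)) h
    simpa only [Finset.prod_X_add_C_coeff _ _ (Nat.sub_le _ k), Nat.sub_sub_self hk] using hc
  · simp [Finset.powersetCard_eq_empty.mpr (not_le.mp hk)]

/-- Elementary symmetric functions do not change when two entries are replaced by a pair with
the same sum and product. -/
theorem esym_eq_of_pair {R : Type*} [CommRing R] {ι : Type*} [Fintype ι] [DecidableEq ι]
    {v w : ι → R} {a b : ι} (hab : a ≠ b) (hne : ∀ j, j ≠ a → j ≠ b → v j = w j)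
    (hadd : v a + v b = w a + w b) (hmul : v a * v b = w a * w b) (k : ℕ) :
    esym k v = esym k w := by
  apply esym_eq_of_prod_X_add_C_eq
  have hb : b ∈ Finset.univ.erase a := by simp [hab.symm]
  rw [← Finset.mul_prod_erase _ _ (Finset.mem_univ a), ← Finset.mul_prod_erase _ _ hb,
    ← Finset.mul_prod_erase _ _ (Finset.mem_univ a), ← Finset.mul_prod_erase _ _ hb,
    ← mul_assoc, ← mul_assoc]
  congr 1
  · have h₁ := congrArg Polynomial.C hadd
    have h₂ := congrArg Polynomial.C hmul
    simp only [Polynomial.C_add, Polynomial.C_mul] at h₁ h₂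
    linear_combination Polynomial.X * h₁ + h₂
  · refine Finset.prod_congr rfl fun j hj => ?_
    simp only [Finset.mem_erase, Finset.mem_univ, and_true] at hj
    rw [hne j hj.2 hj.1]

/-- The sum of the `δ_t` with `i_t = c` over the first `n` letters. -/
def partialδhat (m l : ℕ) (i : Fin l → Fin (m + 1)) (n : ℕ) (c : ℤ) : BSRing m l i :=
  ∑ t ∈ Finset.univ.filter fun t : Fin l => (t : ℕ) < n ∧ ((i t : ℕ) : ℤ) = c, δB m l i t

/-- The elements `y_j` attached to the first `n` letters. -/
def partialY (m l : ℕ) (i : Fin l → Fin (m + 1)) (n : ℕ) (j : Fin (m + 2)) : BSRing m l i :=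
  xB m l i j + partialδhat m l i n (j : ℤ) - partialδhat m l i n ((j : ℤ) - 1)

theorem partialδhat_succ (m l : ℕ) (i : Fin l → Fin (m + 1)) (t : Fin l) (c : ℤ) :
    partialδhat m l i (t + 1) c =
      partialδhat m l i t c + if ((i t : ℕ) : ℤ) = c then δB m l i t else 0 := by
  have h : (if ((i t : ℕ) : ℤ) = c then δB m l i t else 0) =
      ∑ s : Fin l, if s = t then (if ((i s : ℕ) : ℤ) = c then δB m l i s else 0) else 0 := by
    simp
  unfold partialδhat
  rw [h, Finset.sum_filter, Finset.sum_filter, ← Finset.sum_add_distrib]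
  refine Finset.sum_congr rfl fun s _ => ?_
  simp only [Fin.ext_iff]
  split_ifs <;> first | omega | simp

theorem δB_mul_eq_zero (m l : ℕ) (i : Fin l → Fin (m + 1)) (t : Fin l) :
    δB m l i t * (δB m l i t + partialY m l i t (i t).castSucc
      - partialY m l i t (i t).succ) = 0 := by
  have h : Ideal.Quotient.mk (Ideal.span (Set.range (BSrel m l i))) (BSrel m l i t) = 0 :=
    Ideal.Quotient.eq_zero_iff_mem.mpr (Ideal.subset_span ⟨t, rfl⟩)
  have hsame : ∑ s ∈ Finset.univ.filter (fun s => s < t ∧ i s = i t), δB m l i s =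
      partialδhat m l i t (i t : ℕ) := by
    unfold partialδhat
    congr 1
    ext s
    simp [Fin.ext_iff]
  have hadj : ∑ s ∈ Finset.univ.filter
        (fun s => s < t ∧ ((i s : ℕ) = (i t : ℕ) + 1 ∨ (i t : ℕ) = (i s : ℕ) + 1)),
        δB m l i s =
      partialδhat m l i t ((i t : ℕ) + 1) + partialδhat m l i t ((i t : ℕ) - 1) := by
    unfold partialδhat
    rw [Finset.sum_filter, Finset.sum_filter, Finset.sum_filter, ← Finset.sum_add_distrib]
    refine Finset.sum_congr rfl fun s _ => ?_
    simp only [Fin.lt_def]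
    split_ifs <;> first | omega | simp
  simp only [BSrel, map_mul, map_add, map_sub, map_sum, map_ofNat] at h
  change δB m l i t * (δB m l i t + xB m l i (i t).castSucc - xB m l i (i t).succ
      + 2 * ∑ s ∈ Finset.univ.filter (fun s => s < t ∧ i s = i t), δB m l i s
      - ∑ s ∈ Finset.univ.filter
        (fun s => s < t ∧ ((i s : ℕ) = (i t : ℕ) + 1 ∨ (i t : ℕ) = (i s : ℕ) + 1)),
        δB m l i s) = 0 at h
  rw [hsame, hadj] at h
  simp only [partialY, Fin.val_castSucc, Fin.val_succ, Nat.cast_add, Nat.cast_one,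
    add_sub_cancel_right]
  linear_combination h

theorem esym_partialY_succ (m l : ℕ) (i : Fin l → Fin (m + 1)) (t : Fin l) (k : ℕ) :
    esym k (partialY m l i (t + 1)) = esym k (partialY m l i t) := by
  have hcast : partialY m l i (t + 1) (i t).castSucc =
      partialY m l i t (i t).castSucc + δB m l i t := by
    simp only [partialY, partialδhat_succ, Fin.val_castSucc, if_true]
    rw [if_neg (by omega)]
    ring
  have hsucc : partialY m l i (t + 1) (i t).succ =
      partialY m l i t (i t).succ - δB m l i t := by
    simp only [partialY, partialδhat_succ, Fin.val_succ, Nat.cast_add, Nat.cast_one,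
      add_sub_cancel_right, if_true]
    rw [if_neg (by omega)]
    ring
  refine esym_eq_of_pair (a := (i t).castSucc) (b := (i t).succ) (Fin.castSucc_lt_succ).ne
    (fun j hja hjb => ?_) ?_ ?_ k
  · simp only [ne_eq, Fin.ext_iff, Fin.val_castSucc, Fin.val_succ] at hja hjb
    simp only [partialY, partialδhat_succ]
    rw [if_neg (by omega), if_neg (by omega)]
    ring
  · rw [hcast, hsucc]
    ring
  · rw [hcast, hsucc]
    linear_combination -δB_mul_eq_zero m l i t

theorem esym_partialY (m l : ℕ) (i : Fin l → Fin (m + 1)) (k n : ℕ) (hn : n ≤ l) :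
    esym k (partialY m l i n) = esym k (xB m l i) := by
  induction n with
  | zero =>
    congr 1
    funext j
    simp [partialY, partialδhat]
  | succ n ih => exact (esym_partialY_succ m l i ⟨n, hn⟩ k).trans (ih (by omega))

theorem partialY_length (m l : ℕ) (i : Fin l → Fin (m + 1)) :
    partialY m l i l = yB m l i := by
  funext j
  simp [partialY, partialδhat, yB, δhat]

theorem esym_yB (m l : ℕ) (i : Fin l → Fin (m + 1)) (k : ℕ) :
    esym k (yB m l i) = esym k (xB m l i) := by
  rw [← partialY_length, esym_partialY m l i k l le_rfl]

theorem toBS_Frel (m l : ℕ) (i : Fin l → Fin (m + 1)) (j : Fin (m + 2)) :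
    toBS m l i (Frel (m + 2) j) = 0 := by
  have h := esym_yB m l i (j + 1)
  simp only [esym] at h
  simp [toBS, Frel, esym, h]

/-- Let `r = m + 2 ≥ 2` and let `J = (i_1,…,i_l)` be a sequence of
crossing indices.  In the Bott–Samelson ring `R_J`, for every `j ∈ {1,…,r}` one has
`e_j(y_1,…,y_r) = e_j(x_1,…,x_r)`; consequently `x_i ↦ x_i, y_i ↦ y_i` determines a
well-defined ring homomorphism `φ_J : 𝔉 → R_J`. -/
theorem stmt2 (m l : ℕ) (i : Fin l → Fin (m + 1)) :
    (∀ j : Fin (m + 2),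
        esym ((j : ℕ) + 1) (yB m l i) = esym ((j : ℕ) + 1) (xB m l i)) ∧
    ∃ φ : FRing (m + 2) →+* BSRing m l i,
      ∀ p : FPoly (m + 2), φ (Ideal.Quotient.mk _ p) = toBS m l i p := by
  refine ⟨fun j => esym_yB m l i _, Ideal.Quotient.lift _ (toBS m l i) fun p hp => ?_,
    fun p => Ideal.Quotient.lift_mk _ _ _⟩
  have hle : Ideal.span (Set.range (Frel (m + 2))) ≤ RingHom.ker (toBS m l i) := by
    rw [Ideal.span_le]
    rintro _ ⟨j, rfl⟩
    exact toBS_Frel m l i j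
  exact hle hp
end
end

section
/- Let r ≥ 1. In the ring 𝔉 the identity Σ_{k=1}^{r−1} (x_{k+1}² − x_k²)·S_k = Σ_{k=0}^{r−1} (x_{k+1}·(S_k − S_{k+1}) + S_k·S_{k+1})·(S_k − S_{k+1}) holds. -/
noncomputable section
open MvPolynomial

/-- `x_{j+1}` (zero-based index `j`) in `𝔉`; junk value `0` for `j ≥ r`. -/
def xF (r : ℕ) (j : ℕ) : FRing r :=
  if h : j < r then Ideal.Quotient.mk _ (X (Sum.inl ⟨j, h⟩)) else 0

/-- `y_{j+1}` (zero-based index `j`) in `𝔉`; junk value `0` for `j ≥ r`. -/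
def yF (r : ℕ) (j : ℕ) : FRing r :=
  if h : j < r then Ideal.Quotient.mk _ (X (Sum.inr ⟨j, h⟩)) else 0

/-- `S_m = Σ_{i=1}^m (y_i − x_i) ∈ 𝔉` for `0 ≤ m ≤ r − 1`, with the convention
`S_m = 0` for `m ≥ r` (in particular `S_r = 0`). -/
def SF (r : ℕ) (m : ℕ) : FRing r :=
  if m < r then ∑ j ∈ Finset.range m, (yF r j - xF r j) else 0

/-- The `k`-th elementary symmetric function of the first `n` terms of a sequence. -/
def esymRange {R : Type*} [CommRing R] (a : ℕ → R) (k n : ℕ) : R :=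
  ∑ S ∈ (Finset.range n).powersetCard k, ∏ j ∈ S, a j

section esymRange

variable {R : Type*} [CommRing R] (a b : ℕ → R)

lemma esymRange_zero_left (n : ℕ) : esymRange a 0 n = 1 := by
  simp [esymRange]

lemma esymRange_succ_zero (k : ℕ) : esymRange a (k + 1) 0 = 0 := by
  rw [esymRange, Finset.range_zero, Finset.powersetCard_eq_empty.2 (by simp), Finset.sum_empty]

lemma esymRange_succ_succ (k n : ℕ) :
    esymRange a (k + 1) (n + 1) = esymRange a (k + 1) n + a n * esymRange a k n := by
  have notMem (S) (hS : S ∈ (Finset.range n).powersetCard k) : n ∉ S := fun h ↦ by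
    simpa using (Finset.mem_powersetCard.1 hS).1 h
  have hdisj : Disjoint ((Finset.range n).powersetCard (k + 1))
      (((Finset.range n).powersetCard k).image (insert n)) := by
    rw [Finset.disjoint_left]
    intro S hS hS'
    obtain ⟨T, -, rfl⟩ := Finset.mem_image.1 hS'
    simpa using (Finset.mem_powersetCard.1 hS).1 (Finset.mem_insert_self n T)
  rw [esymRange, Finset.range_add_one, Finset.powersetCard_succ_insert (by simp),
    Finset.sum_union hdisj, Finset.sum_image, esymRange, esymRange, Finset.mul_sum]
  · congr 1
    exact Finset.sum_congr rfl fun S hS ↦ Finset.prod_insert (notMem S hS)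
  · intro S hS T hT hST
    rw [← Finset.erase_insert (notMem S hS), ← Finset.erase_insert (notMem T hT)]
    exact congrArg (fun U ↦ Finset.erase U n) hST

lemma esym_fin (r k : ℕ) : esym k (fun i : Fin r ↦ a i) = esymRange a k r := by
  have h : Finset.range r = (Finset.univ : Finset (Fin r)).map Fin.valEmbedding := by
    ext i
    simp
  rw [esymRange, h, Finset.powersetCard_map, Finset.sum_map]
  simp [esym]

lemma map_esym {R' ι : Type*} [CommRing R'] [Fintype ι] [DecidableEq ι] (f : R →+* R')
    (k : ℕ) (v : ι → R) : f (esym k v) = esym k (fun i ↦ f (v i)) := by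
  simp [esym]

lemma esymRange_one (n : ℕ) : esymRange a 1 n = ∑ j ∈ Finset.range n, a j := by
  simp [esymRange, Finset.powersetCard_one]

/-- Partial sums of `a b (b - a) - S S' (S' - S)`, where `S` and `S'` are consecutive partial
sums of `b - a`, in terms of elementary symmetric functions. It is the third part of the
difference of cubic power sums, and the division by `3` is what makes it integral. -/
lemma sum_range_eq_esymRange (n : ℕ) :
    ∑ k ∈ Finset.range n, (a k * b k * (b k - a k) -
        (esymRange b 1 k - esymRange a 1 k) * (esymRange b 1 (k + 1) - esymRange a 1 (k + 1)) *
          (b k - a k)) =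
      (esymRange b 3 n - esymRange a 3 n)
        - (esymRange b 1 n * esymRange b 2 n - esymRange a 1 n * esymRange a 2 n)
        + esymRange a 1 n * esymRange b 1 n * (esymRange b 1 n - esymRange a 1 n) := by
  induction n with
  | zero => simp [esymRange_succ_zero]
  | succ n ih =>
    rw [Finset.sum_range_succ, ih]
    simp only [esymRange_succ_succ, esymRange_zero_left]
    ring

/-- Summation by parts for a sequence vanishing at both ends. -/
lemma sum_range_pred_sub_mul (u S : ℕ → R) (n : ℕ) (h0 : S 0 = 0) (hn : S (n + 1) = 0) :
    ∑ k ∈ Finset.range n, (u (k + 1) - u k) * S (k + 1) =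
      ∑ k ∈ Finset.range (n + 1), u k * (S k - S (k + 1)) := by
  simp only [mul_sub, sub_mul, Finset.sum_sub_distrib]
  rw [Finset.sum_range_succ' (fun k ↦ u k * S k), Finset.sum_range_succ (fun k ↦ u k * S (k + 1)),
    h0, hn]
  simp

end esymRange

lemma esymRange_xF_eq_yF (r k : ℕ) : esymRange (xF r) k r = esymRange (yF r) k r := by
  cases k with
  | zero => simp only [esymRange_zero_left]
  | succ k =>
    by_cases hk : k < r
    · have h : Ideal.Quotient.mk (Ideal.span (Set.range (Frel r))) (Frel r ⟨k, hk⟩) = 0 :=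
        Ideal.Quotient.eq_zero_iff_mem.2 (Ideal.subset_span ⟨_, rfl⟩)
      rw [Frel, map_sub, map_esym, map_esym, sub_eq_zero] at h
      rw [← esym_fin, ← esym_fin]
      simpa [xF, yF] using h
    · have h : (Finset.range r).powersetCard (k + 1) = ∅ :=
        Finset.powersetCard_eq_empty.2 (by simp; omega)
      simp [esymRange, h]

lemma SF_eq_esymRange {r m : ℕ} (hm : m ≤ r) :
    SF r m = esymRange (yF r) 1 m - esymRange (xF r) 1 m := by
  rcases hm.lt_or_eq with h | rfl
  · rw [SF, if_pos h, Finset.sum_sub_distrib, esymRange_one, esymRange_one]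
  · rw [esymRange_xF_eq_yF, sub_self, SF, if_neg (lt_irrefl _)]

/-- For `r ≥ 1`, in the ring `𝔉` the identity
`Σ_{k=1}^{r−1} (x_{k+1}² − x_k²)·S_k
  = Σ_{k=0}^{r−1} (x_{k+1}·(S_k − S_{k+1}) + S_k·S_{k+1})·(S_k − S_{k+1})` holds
(zero-based: `x_k = xF r (k−1)`; in the first sum the index runs over `k − 1`). -/
theorem stmt5 (r : ℕ) (hr : 1 ≤ r) :
    ∑ k ∈ Finset.range (r - 1), (xF r (k + 1) ^ 2 - xF r k ^ 2) * SF r (k + 1)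
      = ∑ k ∈ Finset.range r,
          (xF r k * (SF r k - SF r (k + 1)) + SF r k * SF r (k + 1)) *
            (SF r k - SF r (k + 1)) := by
  obtain ⟨n, rfl⟩ := Nat.exists_eq_add_of_le' hr
  rw [Nat.add_sub_cancel, sum_range_pred_sub_mul (fun k ↦ xF (n + 1) k ^ 2) _ _ (by simp [SF])
    (by simp [SF]), ← sub_eq_zero, ← Finset.sum_sub_distrib]
  have key := sum_range_eq_esymRange (xF (n + 1)) (yF (n + 1)) (n + 1)
  simp only [esymRange_xF_eq_yF, sub_self, mul_zero, add_zero] at key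
  rw [← neg_eq_zero, ← key, ← Finset.sum_neg_distrib]
  refine Finset.sum_congr rfl fun k hk ↦ ?_
  have hk : k < n + 1 := Finset.mem_range.1 hk
  rw [SF_eq_esymRange hk.le, SF_eq_esymRange hk]
  simp only [esymRange_succ_succ, esymRange_zero_left]
  ring
end
end
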